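/- Weak Kőnig's Lemma is strongly Weihrauch equivalent to the parallelized lesser limited principle of omniscience: WKL ≡_sW \widehat{LLPO}. -/

import Mathlib

/-- Baire space `ℕ^ℕ` with the product topology (`ℕ` discrete). -/
abbrev Baire : Type := ℕ → ℕ

/-- The pairing `⟨p,q⟩` on Baire space: `⟨p,q⟩(2n) = p(n)`, `⟨p,q⟩(2n+1) = q(n)`. -/
def bpair (p q : Baire) : Baire := fun n => if n % 2 = 0 then p (n / 2) else q (n / 2)

/-- First projection `π₁`. -/
def proj1 (r : Baire) : Baire := fun n => r (2 * n)

/-- Second projection `π₂`. -/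
def proj2 (r : Baire) : Baire := fun n => r (2 * n + 1)

/-- Multi-valued functions on Baire space. -/
abbrev MV : Type := Baire → Set Baire

/-- The domain of a multi-valued function. -/
def dom (f : MV) : Set Baire := {p | (f p).Nonempty}

/-- `F` is a realizer of `f`: `F p ∈ f p` for all `p` in the domain of `f`. -/
def Realizes (F : Baire → Baire) (f : MV) : Prop := ∀ p, (f p).Nonempty → F p ∈ f p

/-- Continuous Weihrauch reducibility `f ≤_W g`. -/
def WRed (f g : MV) : Prop :=
  ∃ H K : Baire → Baire, Continuous H ∧ Continuous K ∧
    ∀ G : Baire → Baire, Realizes G g → Realizes (fun p => H (bpair p (G (K p)))) f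

/-- Strong continuous Weihrauch reducibility `f ≤_sW g`. -/
def SWRed (f g : MV) : Prop :=
  ∃ H K : Baire → Baire, Continuous H ∧ Continuous K ∧
    ∀ G : Baire → Baire, Realizes G g → Realizes (fun p => H (G (K p))) f

/-- Continuous Weihrauch equivalence. -/
def WEquiv (f g : MV) : Prop := WRed f g ∧ WRed g f

/-- Strong continuous Weihrauch equivalence. -/
def SWEquiv (f g : MV) : Prop := SWRed f g ∧ SWRed g f

/-- The parallelized lesser limited principle of omniscience. -/
def parLLPO : MV := fun p =>
  {q | ∀ k, (q k = 0 ∧ ∀ n, p (Nat.pair k (2 * n)) = 0) ∨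
            (q k = 1 ∧ ∀ n, p (Nat.pair k (2 * n + 1)) = 0)}

/-- The tree coded by `p` via the bijection `e : List Bool ≃ ℕ`. -/
def treeSet (e : List Bool ≃ ℕ) (p : Baire) : Set (List Bool) := {l | p (e l) = 1}

/-- `p` codes an infinite binary tree: the coded set of words is closed under
prefixes and infinite. -/
def codesTree (e : List Bool ≃ ℕ) (p : Baire) : Prop :=
  (∀ l₁ l₂ : List Bool, l₁ <+: l₂ → l₂ ∈ treeSet e p → l₁ ∈ treeSet e p) ∧
    (treeSet e p).Infinite

/-- Weak Kőnig's Lemma: `WKL(p)` is the set of infinite paths of the tree coded by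
`p` when `p` codes an infinite binary tree, and `∅` otherwise. -/
def WKL (e : List Bool ≃ ℕ) : MV := fun p =>
  {q | codesTree e p ∧ (∀ n, q n ≤ 1) ∧
       ∀ n, (List.ofFn fun k : Fin n => decide (q k = 1)) ∈ treeSet e p}

/-- Number of words of the form `l ++ v`, `v` of length `n`, in the tree coded by `p`. -/
def cntExt (e : List Bool ≃ ℕ) (p : Baire) (l : List Bool) (n : ℕ) : ℕ :=
  ∑ v : Fin n → Bool, if p (e (l ++ List.ofFn v)) = 1 then 1 else 0

theorem cont_nat_comp (g : ℕ → ℕ) (i : ℕ) : Continuous fun p : Baire => g (p i) :=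
  (continuous_of_discreteTopology (f := g)).comp (continuous_apply i)

theorem cntExt_cont (e : List Bool ≃ ℕ) (l : List Bool) (n : ℕ) :
    Continuous fun p => cntExt e p l n := by
  unfold cntExt
  exact continuous_finsetSum _ fun v _ => cont_nat_comp (fun x => if x = 1 then 1 else 0) _

theorem cntExt_ne (e : List Bool ≃ ℕ) (p : Baire) (l : List Bool) (n : ℕ) :
    cntExt e p l n ≠ 0 ↔ ∃ v : List Bool, v.length = n ∧ p (e (l ++ v)) = 1 := by
  unfold cntExt
  rw [Ne, Finset.sum_eq_zero_iff]
  constructor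
  · intro h
    push Not at h
    obtain ⟨v, -, hv⟩ := h
    refine ⟨List.ofFn v, by simp, ?_⟩
    by_contra hc
    simp [hc] at hv
  · rintro ⟨v, rfl, hv⟩ h
    have := h v.get (Finset.mem_univ _)
    simp [hv] at this

/-- The question asked for the word `l`. -/
def Kone (e : List Bool ≃ ℕ) (p : Baire) : Baire := fun m =>
  let l := e.symm m.unpair.1
  let j := m.unpair.2
  if cntExt e p (l ++ [decide (j % 2 = 1)]) (j / 2) = 0 ∧
    cntExt e p (l ++ [!decide (j % 2 = 1)]) (j / 2) ≠ 0 then 1 else 0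

theorem Kone_cont (e : List Bool ≃ ℕ) : Continuous (Kone e) := by
  refine continuous_pi fun m => ?_
  unfold Kone
  exact (continuous_of_discreteTopology
    (f := fun x : ℕ × ℕ => if x.1 = 0 ∧ x.2 ≠ 0 then 1 else 0)).comp
    ((cntExt_cont e _ _).prodMk (cntExt_cont e _ _))

/-- Codes of the words along the path chosen by `q`. -/
def pathCode (e : List Bool ≃ ℕ) (q : Baire) : ℕ → ℕ
  | 0 => e []
  | n + 1 => e (e.symm (pathCode e q n) ++ [decide (q (pathCode e q n) = 1)])

theorem eval_cont {f : Baire → ℕ} (hf : Continuous f) : Continuous fun q : Baire => q (f q) := by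
  have : Continuous fun x : ℕ × Baire => x.2 x.1 :=
    continuous_prod_of_discrete_left.mpr fun a => continuous_apply a
  exact this.comp (hf.prodMk continuous_id)

theorem pathCode_cont (e : List Bool ≃ ℕ) (n : ℕ) : Continuous fun q => pathCode e q n := by
  induction n with
  | zero => exact continuous_const
  | succ n ih =>
    exact (continuous_of_discreteTopology
      (f := fun x : ℕ × ℕ => e (e.symm x.1 ++ [decide (x.2 = 1)]))).comp
      (ih.prodMk (eval_cont ih))

def Hone (e : List Bool ≃ ℕ) (q : Baire) : Baire := fun n =>
  if q (pathCode e q n) = 1 then 1 else 0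

theorem Hone_cont (e : List Bool ≃ ℕ) : Continuous (Hone e) := by
  refine continuous_pi fun n => ?_
  exact (continuous_of_discreteTopology (f := fun x : ℕ => if x = 1 then 1 else 0)).comp
    (eval_cont (pathCode_cont e n))

theorem ofFn_Hone (e : List Bool ≃ ℕ) (q : Baire) (n : ℕ) :
    (List.ofFn fun k : Fin n => decide (Hone e q k = 1)) = e.symm (pathCode e q n) := by
  induction n with
  | zero => simp [pathCode]
  | succ n ih =>
    rw [List.ofFn_succ', pathCode, Equiv.symm_apply_apply, ← ih]
    simp [Hone]

theorem cntExt_mono (e : List Bool ≃ ℕ) (p : Baire) (hp : codesTree e p) (l : List Bool)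
    {m n : ℕ} (hmn : m ≤ n) (h : cntExt e p l n ≠ 0) : cntExt e p l m ≠ 0 := by
  rw [cntExt_ne] at *
  obtain ⟨v, rfl, hv⟩ := h
  refine ⟨v.take m, by simp [hmn], hp.1 _ _ ?_ hv⟩
  exact (List.prefix_append_right_inj l).2 (List.take_prefix _ _)

theorem cntExt_nil (e : List Bool ≃ ℕ) (p : Baire) (hp : codesTree e p) (n : ℕ) :
    cntExt e p [] n ≠ 0 := by
  rw [cntExt_ne]
  have hfin : {l : List Bool | l.length < n}.Finite := List.finite_length_lt Bool n
  obtain ⟨l, hl, hl'⟩ := hp.2.exists_notMem_finite hfin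
  simp only [Set.mem_ofPred_eq, not_lt] at hl'
  exact ⟨l.take n, by simp [hl'], hp.1 _ _ (List.take_prefix _ _) hl⟩

theorem cntExt_split (e : List Bool ≃ ℕ) (p : Baire) (l : List Bool) (b : Bool) (n : ℕ)
    (h : cntExt e p l (n + 1) ≠ 0) :
    cntExt e p (l ++ [b]) n ≠ 0 ∨ cntExt e p (l ++ [!b]) n ≠ 0 := by
  simp only [cntExt_ne] at *
  obtain ⟨v, hv, hv'⟩ := h
  match v, hv with
  | c :: v, hv =>
    have hlen : v.length = n := by simpa using hv
    by_cases hc : c = b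
    · subst hc
      exact Or.inl ⟨v, hlen, by simpa using hv'⟩
    · have : c = !b := by cases b <;> cases c <;> simp_all
      subst this
      exact Or.inr ⟨v, hlen, by simpa using hv'⟩

theorem Kone_even (e : List Bool ≃ ℕ) (p : Baire) (k n : ℕ) :
    Kone e p (Nat.pair k (2 * n)) = 0 ↔
      (cntExt e p (e.symm k ++ [true]) n ≠ 0 → cntExt e p (e.symm k ++ [false]) n ≠ 0) := by
  simp [Kone, Nat.unpair_pair]
  tauto

theorem Kone_odd (e : List Bool ≃ ℕ) (p : Baire) (k n : ℕ) :
    Kone e p (Nat.pair k (2 * n + 1)) = 0 ↔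
      (cntExt e p (e.symm k ++ [false]) n ≠ 0 → cntExt e p (e.symm k ++ [true]) n ≠ 0) := by
  have h1 : (2 * n + 1) % 2 = 1 := by omega
  have h2 : (2 * n + 1) / 2 = n := by omega
  simp [Kone, Nat.unpair_pair, h1, h2]
  tauto

theorem Kone_dom (e : List Bool ≃ ℕ) (p : Baire) (hp : codesTree e p) :
    (parLLPO (Kone e p)).Nonempty := by
  have : ∀ k, ∃ x : ℕ, (x = 0 ∧ ∀ n, Kone e p (Nat.pair k (2 * n)) = 0) ∨
            (x = 1 ∧ ∀ n, Kone e p (Nat.pair k (2 * n + 1)) = 0) := by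
    intro k
    by_cases h : ∀ n, Kone e p (Nat.pair k (2 * n)) = 0
    · exact ⟨0, Or.inl ⟨rfl, h⟩⟩
    · refine ⟨1, Or.inr ⟨rfl, fun m => ?_⟩⟩
      push Not at h
      obtain ⟨n, hn⟩ := h
      rw [Ne, Kone_even, Classical.not_imp] at hn
      rw [Kone_odd]
      intro hm
      rcases le_total m n with hmn | hmn
      · exact cntExt_mono e p hp _ hmn hn.1
      · exact absurd (cntExt_mono e p hp _ hmn hm) hn.2
  choose q hq using this
  exact ⟨q, hq⟩

theorem path_ext (e : List Bool ≃ ℕ) (p : Baire) (hp : codesTree e p) (q : Baire)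
    (hq : q ∈ parLLPO (Kone e p)) (n : ℕ) :
    ∀ m, cntExt e p (e.symm (pathCode e q n)) m ≠ 0 := by
  induction n with
  | zero => simpa [pathCode] using cntExt_nil e p hp
  | succ n ih =>
    intro m
    rw [pathCode, Equiv.symm_apply_apply]
    rcases hq (pathCode e q n) with ⟨h, h'⟩ | ⟨h, h'⟩
    · have h2 := (Kone_even e p _ m).1 (h' m)
      have h3 := cntExt_split e p _ false m (ih (m + 1))
      simp only [h, Bool.not_false] at *
      exact h3.elim id h2
    · have h2 := (Kone_odd e p _ m).1 (h' m)
      have h3 := cntExt_split e p _ true m (ih (m + 1))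
      simp only [h, Bool.not_true] at *
      exact h3.elim id h2

theorem wkl_le (e : List Bool ≃ ℕ) : SWRed (WKL e) parLLPO := by
  refine ⟨Hone e, Kone e, Hone_cont e, Kone_cont e, fun G hG p hne => ?_⟩
  obtain ⟨_, hp, -⟩ := hne
  have hq := hG _ (Kone_dom e p hp)
  refine ⟨hp, fun n => ?_, fun n => ?_⟩
  · simp only [Hone]
    split_ifs <;> simp
  · simp only [ofFn_Hone]
    have := path_ext e p hp _ hq n 0
    rw [cntExt_ne] at this
    obtain ⟨v, hv, hmem⟩ := this
    rw [List.length_eq_zero_iff] at hv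
    subst hv
    simpa [treeSet] using hmem

/-- The tree of finite approximations of solutions of `parLLPO p`. -/
def Ktwo (e : List Bool ≃ ℕ) (p : Baire) : Baire := fun m =>
  let l := e.symm m
  if (∑ k ∈ Finset.range l.length, ∑ n ∈ Finset.range l.length,
    p (Nat.pair k (2 * n + (l.getD k false).toNat))) = 0 then 1 else 0

theorem Ktwo_cont (e : List Bool ≃ ℕ) : Continuous (Ktwo e) := by
  refine continuous_pi fun m => ?_
  unfold Ktwo
  exact (continuous_of_discreteTopology (f := fun x : ℕ => if x = 0 then 1 else 0)).comp
    (continuous_finsetSum _ fun k _ => continuous_finsetSum _ fun n _ => continuous_apply _)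

theorem mem_Ktwo (e : List Bool ≃ ℕ) (p : Baire) (l : List Bool) :
    l ∈ treeSet e (Ktwo e p) ↔ ∀ k < l.length, ∀ n < l.length,
      p (Nat.pair k (2 * n + (l.getD k false).toNat)) = 0 := by
  simp [treeSet, Ktwo, Finset.sum_eq_zero_iff]

theorem mem_Ktwo_ofFn (e : List Bool ≃ ℕ) (p q : Baire) (N : ℕ) :
    (List.ofFn fun k : Fin N => decide (q k = 1)) ∈ treeSet e (Ktwo e p) ↔
      ∀ k < N, ∀ n < N, p (Nat.pair k (2 * n + (decide (q k = 1)).toNat)) = 0 := by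
  rw [mem_Ktwo]
  simp only [List.length_ofFn]
  refine forall₂_congr fun k hk => ?_
  have : (List.ofFn fun k : Fin N => decide (q k = 1)).getD k false = decide (q k = 1) := by
    simp [List.getD, hk]
  rw [this]

theorem Ktwo_dom (e : List Bool ≃ ℕ) (p q : Baire) (hq : q ∈ parLLPO p) :
    q ∈ WKL e (Ktwo e p) := by
  have hmem : ∀ N, (List.ofFn fun k : Fin N => decide (q k = 1)) ∈ treeSet e (Ktwo e p) := by
    intro N
    rw [mem_Ktwo_ofFn]
    intro k _ n _
    rcases hq k with ⟨h, h'⟩ | ⟨h, h'⟩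
    · simpa [h] using h' n
    · simpa [h] using h' n
  refine ⟨⟨?_, ?_⟩, fun n => ?_, hmem⟩
  · rintro l₁ l₂ ⟨t, rfl⟩ h
    rw [mem_Ktwo] at *
    intro k hk n hn
    have := h k (by simp; omega) n (by simp; omega)
    rwa [List.getD_append _ _ _ _ hk] at this
  · refine Set.infinite_of_injective_forall_mem (f := fun N : ℕ =>
      List.ofFn fun k : Fin N => decide (q k = 1)) ?_ hmem
    intro a b hab
    simpa using congrArg List.length hab
  · rcases hq n with ⟨h, -⟩ | ⟨h, -⟩ <;> omega

theorem le_wkl (e : List Bool ≃ ℕ) : SWRed parLLPO (WKL e) := by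
  refine ⟨id, Ktwo e, continuous_id, Ktwo_cont e, fun G hG p hne => ?_⟩
  obtain ⟨q, hq⟩ := hne
  obtain ⟨-, h1, h2⟩ := hG _ ⟨q, Ktwo_dom e p q hq⟩
  intro k
  simp only [id]
  have h3 : ∀ n, p (Nat.pair k (2 * n + (decide (G (Ktwo e p) k = 1)).toNat)) = 0 := fun n =>
    (mem_Ktwo_ofFn e p _ (k + n + 1)).1 (h2 _) k (by omega) n (by omega)
  have h4 := h1 k
  rcases Nat.le_one_iff_eq_zero_or_eq_one.1 h4 with h | h
  · left
    exact ⟨h, by simpa [h] using h3⟩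
  · right
    exact ⟨h, by simpa [h] using h3⟩

/-- Weak Kőnig's Lemma is strongly Weihrauch equivalent to parallelized `LLPO`. -/
theorem wkl_equiv_parLLPO (e : List Bool ≃ ℕ) : SWEquiv (WKL e) parLLPO :=
  ⟨wkl_le e, le_wkl e⟩
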